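/- (Theorem 4.4: generalized Painlevé IV system.) For every integer n ≥ 1, every index 1 ≤ j ≤ N and every t ∈ U with R_{n,j}(t) ≠ 0: (1/2)·δ²R_{n,j} = (δR_{n,j})²/(4R_{n,j}) − [Σ_{k=1}^N ((t_k − (1/2)Σ_{l=1}^N R_{n,l})·R_{n,k} + γ_k)]·R_{n,j} + (t_j − (1/2)Σ_{k=1}^N R_{n,k})²·R_{n,j} − (2n+1)·R_{n,j} − γ_j²/R_{n,j}, where δR_{n,j} = Σ_{k=1}^N ∂_kR_{n,j} and δ²R_{n,j} = Σ_{k=1}^N Σ_{l=1}^N ∂_k∂_lR_{n,j}. -/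

import Mathlib

open MeasureTheory Polynomial

noncomputable def pd {N : ℕ} (j : Fin N) (f : (Fin N → ℝ) → ℝ) (x : Fin N → ℝ) : ℝ :=
  deriv (fun s => f (Function.update x j s)) (x j)

/-- `F` is integrable against every weight `exp (B * |z| - z ^ 2)`. -/
def GaussAdmissible (F : ℝ → ℝ) : Prop :=
  ∀ B : ℝ, Integrable (fun z => F z * Real.exp (B * |z| - z ^ 2))

lemma exists_abs_eval_le_exp (q : ℝ[X]) :
    ∃ C B : ℝ, 0 ≤ C ∧ 0 ≤ B ∧ ∀ y : ℝ, |q.eval y| ≤ C * Real.exp (B * |y|) := by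
  induction q using Polynomial.induction_on' with
  | add p q hp hq =>
    obtain ⟨C, B, hC, hB, h1⟩ := hp
    obtain ⟨C', B', hC', hB', h2⟩ := hq
    refine ⟨C + C', max B B', by positivity, le_max_of_le_left hB, fun y => ?_⟩
    have e1 : Real.exp (B * |y|) ≤ Real.exp (max B B' * |y|) := by
      gcongr
      exact le_max_left _ _
    have e2 : Real.exp (B' * |y|) ≤ Real.exp (max B B' * |y|) := by
      gcongr
      exact le_max_right _ _
    rw [eval_add, add_mul]
    refine (abs_add_le _ _).trans (add_le_add ((h1 y).trans ?_) ((h2 y).trans ?_)) <;> gcongr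
  | monomial k c =>
    refine ⟨|c|, k, abs_nonneg _, Nat.cast_nonneg _, fun y => ?_⟩
    rw [eval_monomial, abs_mul, abs_pow, Real.exp_nat_mul]
    gcongr
    linarith [Real.add_one_le_exp |y|]

lemma exists_abs_eval_mul_exp_le (q : ℝ[X]) :
    ∃ C B : ℝ, 0 ≤ C ∧ 0 ≤ B ∧ ∀ z s : ℝ, |s| ≤ 1 →
      |q.eval (z + s) * Real.exp (-(z + s) ^ 2)| ≤ C * Real.exp (B * |z| - z ^ 2) := by
  obtain ⟨C, B, hC, hB, h1⟩ := exists_abs_eval_le_exp q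
  refine ⟨C * Real.exp B, B + 2, by positivity, by positivity, fun z s hs => ?_⟩
  rw [abs_mul, Real.abs_exp]
  have hz : |z + s| ≤ |z| + 1 := (abs_add_le _ _).trans (by gcongr)
  have hzs : -(z * s) ≤ |z| := by
    calc -(z * s) ≤ |z * s| := neg_le_abs _
      _ = |z| * |s| := abs_mul _ _
      _ ≤ |z| * 1 := by gcongr
      _ = |z| := mul_one _
  calc |q.eval (z + s)| * Real.exp (-(z + s) ^ 2)
      ≤ (C * Real.exp (B * (|z| + 1))) * Real.exp (2 * |z| - z ^ 2) := by
        gcongr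
        · exact (h1 _).trans (by gcongr)
        · nlinarith [sq_nonneg s]
    _ = C * Real.exp B * Real.exp ((B + 2) * |z| - z ^ 2) := by
        rw [mul_assoc, mul_assoc, ← Real.exp_add, ← Real.exp_add]
        congr 2
        ring

lemma GaussAdmissible.aestronglyMeasurable_mul {F : ℝ → ℝ} (hF : GaussAdmissible F)
    {g : ℝ → ℝ} (hg : Continuous g) : AEStronglyMeasurable (fun z => F z * g z) volume := by
  have h0 := (hF 0).aestronglyMeasurable
  have h1 : AEStronglyMeasurable (fun z : ℝ => Real.exp (z ^ 2) * g z) volume :=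
    (by fun_prop : Continuous fun z : ℝ => Real.exp (z ^ 2) * g z).aestronglyMeasurable
  refine (h0.mul h1).congr (Filter.Eventually.of_forall fun z => ?_)
  have : Real.exp (0 * |z| - z ^ 2) * Real.exp (z ^ 2) = 1 := by
    rw [← Real.exp_add]
    simp
  simp only [Pi.mul_apply]
  linear_combination (F z * g z) * this

lemma GaussAdmissible.integrable_shift {F : ℝ → ℝ} (hF : GaussAdmissible F) (q : ℝ[X])
    {s : ℝ} (hs : |s| ≤ 1) :
    Integrable (fun z => F z * (q.eval (z + s) * Real.exp (-(z + s) ^ 2))) := by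
  obtain ⟨C, B, hC, -, hb⟩ := exists_abs_eval_mul_exp_le q
  refine ((hF B).norm.const_mul C).mono' (hF.aestronglyMeasurable_mul ?_)
    (Filter.Eventually.of_forall fun z => ?_)
  · have := q.continuous
    fun_prop
  · rw [norm_mul, norm_mul (F z), Real.norm_eq_abs (Real.exp _), Real.abs_exp, mul_left_comm]
    exact mul_le_mul_of_nonneg_left (hb z s hs) (norm_nonneg _)

lemma GaussAdmissible.integrable {F : ℝ → ℝ} (hF : GaussAdmissible F) (q : ℝ[X]) :
    Integrable (fun z => F z * (q.eval z * Real.exp (-z ^ 2))) := by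
  simpa using hF.integrable_shift q (s := 0) (by simp)

lemma GaussAdmissible.hasDerivAt_integral_shift {F : ℝ → ℝ} (hF : GaussAdmissible F)
    (q : ℝ[X]) :
    HasDerivAt (fun s => ∫ z, F z * (q.eval (z + s) * Real.exp (-(z + s) ^ 2)))
      (∫ z, F z * ((derivative q - 2 * X * q).eval z * Real.exp (-z ^ 2))) 0 := by
  set q' := derivative q - 2 * X * q with hq'
  obtain ⟨C, B, hC, -, hb⟩ := exists_abs_eval_mul_exp_le q'
  have key := hasDerivAt_integral_of_dominated_loc_of_deriv_le (μ := volume) (𝕜 := ℝ)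
    (F := fun s z => F z * (q.eval (z + s) * Real.exp (-(z + s) ^ 2)))
    (F' := fun s z => F z * (q'.eval (z + s) * Real.exp (-(z + s) ^ 2)))
    (bound := fun z => C * ‖F z * Real.exp (B * |z| - z ^ 2)‖)
    (s := Metric.ball 0 1) (x₀ := 0) (Metric.ball_mem_nhds _ one_pos) ?_ ?_ ?_ ?_ ?_ ?_
  · simpa using key.2
  · refine Filter.Eventually.of_forall fun s => hF.aestronglyMeasurable_mul ?_
    have := q.continuous
    fun_prop
  · exact hF.integrable_shift q (by simp)
  · exact (hF.integrable_shift q' (by simp)).aestronglyMeasurable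
  · refine Filter.Eventually.of_forall fun z s hs => ?_
    rw [norm_mul, norm_mul (F z), Real.norm_eq_abs (Real.exp _), Real.abs_exp, mul_left_comm]
    exact mul_le_mul_of_nonneg_left (hb z s (mem_ball_zero_iff.1 hs).le) (norm_nonneg _)
  · exact (hF B).norm.const_mul C
  · refine Filter.Eventually.of_forall fun z s _ => ?_
    have hs : HasDerivAt (fun s : ℝ => z + s) 1 s := (hasDerivAt_id s).const_add z
    have h1 := (q.hasDerivAt (z + s)).comp s hs
    have h2 := ((hs.pow 2).neg).exp
    refine ((h1.mul h2).const_mul (F z)).congr_deriv ?_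
    simp [hq', -mul_eq_mul_left_iff]
    ring

/-- Integration of polynomials against `F z * exp (-z ^ 2)`. -/
noncomputable def GaussAdmissible.functional {F : ℝ → ℝ} (hF : GaussAdmissible F) :
    ℝ[X] →ₗ[ℝ] ℝ where
  toFun q := ∫ z, F z * (q.eval z * Real.exp (-z ^ 2))
  map_add' p q := by
    rw [← integral_add (hF.integrable p) (hF.integrable q)]
    simp only [eval_add, add_mul, mul_add]
  map_smul' c q := by
    simp only [eval_smul, smul_eq_mul, RingHom.id_apply, mul_assoc, mul_left_comm _ c]
    rw [integral_const_mul]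

lemma GaussAdmissible.functional_apply {F : ℝ → ℝ} (hF : GaussAdmissible F) (q : ℝ[X]) :
    hF.functional q = ∫ z, F z * (q.eval z * Real.exp (-z ^ 2)) := rfl

lemma integrable_abs_rpow_mul_exp_neg_mul_sq {b s : ℝ} (hb : 0 < b) (hs : -1 < s) :
    Integrable (fun u : ℝ => |u| ^ s * Real.exp (-b * u ^ 2)) := by
  have h := integrableOn_rpow_mul_exp_neg_mul_sq hb hs
  have h1 : IntegrableOn (fun u : ℝ => |u| ^ s * Real.exp (-b * u ^ 2)) (Set.Ioi 0) :=
    h.congr_fun (fun u hu => by simp only [abs_of_pos (Set.mem_Ioi.1 hu)]) measurableSet_Ioi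
  rw [← integrableOn_univ, ← Set.Iio_union_Ici (a := (0 : ℝ)), integrableOn_union,
    integrableOn_Ici_iff_integrableOn_Ioi]
  refine ⟨?_, h1⟩
  rw [← (Measure.measurePreserving_neg (volume : Measure ℝ)).integrableOn_comp_preimage
    (Homeomorph.neg ℝ).measurableEmbedding]
  simpa only [Function.comp_def, neg_sq, Set.neg_preimage, Set.neg_Iio, neg_zero, abs_neg] using h1

lemma gaussAdmissible_of_abs_le {F : ℝ → ℝ} (hF : AEStronglyMeasurable F volume)
    {A B a s : ℝ} (hs : -1 < s)
    (hb : ∀ z, |F z| ≤ Real.exp (A + B * |z - a|) * |z - a| ^ s) : GaussAdmissible F := by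
  intro D
  have h1 := ((integrable_abs_rpow_mul_exp_neg_mul_sq (b := 1 / 2) (by norm_num) hs).comp_sub_right
    a).const_mul (Real.exp (A + |D| * |a| + (B + |D| + 2 * |a|) ^ 2 / 2))
  refine h1.mono' (hF.mul (by fun_prop :
    Continuous fun z : ℝ => Real.exp (D * |z| - z ^ 2)).aestronglyMeasurable)
    (Filter.Eventually.of_forall fun z => ?_)
  rw [norm_mul, Real.norm_eq_abs (Real.exp _), Real.abs_exp]
  have hz : |z| ≤ |z - a| + |a| := by simpa using abs_add_le (z - a) a
  have hD : D * |z| ≤ |D| * (|z - a| + |a|) :=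
    mul_le_mul (le_abs_self D) hz (abs_nonneg _) (abs_nonneg _)
  have hza : -((z - a) * a) ≤ |z - a| * |a| := (neg_le_abs _).trans (abs_mul _ _).le
  calc ‖F z‖ * Real.exp (D * |z| - z ^ 2)
      ≤ (Real.exp (A + B * |z - a|) * |z - a| ^ s) * Real.exp (D * |z| - z ^ 2) := by
        gcongr
        exact hb z
    _ = |z - a| ^ s * Real.exp (A + B * |z - a| + (D * |z| - z ^ 2)) := by
        rw [Real.exp_add (A + B * |z - a|)]
        ring
    _ ≤ |z - a| ^ s * Real.exp (A + |D| * |a| + (B + |D| + 2 * |a|) ^ 2 / 2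
          + -(1 / 2) * (z - a) ^ 2) := by
        refine mul_le_mul_of_nonneg_left (Real.exp_le_exp.2 ?_) (by positivity)
        nlinarith [sq_nonneg (|z - a| - (B + |D| + 2 * |a|)), sq_abs (z - a), sq_nonneg a]
    _ = _ := by
        rw [Real.exp_add]
        ring

lemma prod_abs_rpow_le {ι : Type*} (S : Finset ι) (γ : ι → ℝ) (hγ : ∀ k, 0 < γ k) (x : ι → ℝ)
    (a z : ℝ) : ∏ k ∈ S, |z - x k| ^ γ k ≤
      Real.exp (∑ k ∈ S, γ k * |a - x k| + (∑ k ∈ S, γ k) * |z - a|) := by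
  rw [Finset.sum_mul, ← Finset.sum_add_distrib, Real.exp_sum]
  refine Finset.prod_le_prod (fun k _ => by positivity) fun k _ => ?_
  have h1 : |z - x k| ≤ Real.exp |z - x k| := by linarith [Real.add_one_le_exp |z - x k|]
  have h2 : |z - x k| ≤ |z - a| + |a - x k| := abs_sub_le _ _ _
  calc |z - x k| ^ γ k ≤ Real.exp |z - x k| ^ γ k := by
        have := hγ k
        gcongr
    _ = Real.exp (γ k * |z - x k|) := by rw [← Real.exp_mul, mul_comm]
    _ ≤ _ := by
        have := hγ k
        gcongr
        nlinarith

/-- The algebraic factor `∏ k, |z - x k| ^ γ k` of the weight. -/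
noncomputable def absProd {N : ℕ} (γ x : Fin N → ℝ) (z : ℝ) : ℝ := ∏ k, |z - x k| ^ γ k

section AbsProd

variable {N : ℕ} {γ : Fin N → ℝ} (hγ : ∀ k, 0 < γ k) (x : Fin N → ℝ)

lemma absProd_add_const (s z : ℝ) :
    absProd γ (fun k => x k + s) (z + s) = absProd γ x z := by
  simp [absProd]

lemma absProd_nonneg (z : ℝ) : 0 ≤ absProd γ x z :=
  Finset.prod_nonneg fun k _ => by positivity

include hγ

lemma continuous_absProd : Continuous (absProd γ x) :=
  continuous_finsetProd _ fun k _ =>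
    (by fun_prop : Continuous fun z => |z - x k|).rpow_const fun _ => Or.inr (hγ k).le

lemma gaussAdmissible_absProd : GaussAdmissible (absProd γ x) := by
  refine gaussAdmissible_of_abs_le (A := ∑ k, γ k * |0 - x k|) (B := ∑ k, γ k) (a := 0) (s := 0)
    (continuous_absProd hγ x).aestronglyMeasurable (by norm_num) fun z => ?_
  rw [abs_of_nonneg (absProd_nonneg x z), Real.rpow_zero, mul_one]
  exact prod_abs_rpow_le _ γ hγ x 0 z

lemma gaussAdmissible_absProd_div (j : Fin N) :
    GaussAdmissible (fun z => absProd γ x z / (z - x j)) := by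
  refine gaussAdmissible_of_abs_le (A := ∑ k ∈ Finset.univ.erase j, γ k * |x j - x k|)
    (B := ∑ k ∈ Finset.univ.erase j, γ k) (a := x j) (s := γ j - 1)
    ((continuous_absProd hγ x).measurable.div (by fun_prop)).aestronglyMeasurable
    (by linarith [hγ j]) fun z => ?_
  rw [abs_div, abs_of_nonneg (absProd_nonneg x z)]
  rcases eq_or_ne z (x j) with rfl | hz
  · simp only [sub_self, abs_zero, div_zero]
    positivity
  · have hz' : 0 < |z - x j| := abs_pos.2 (sub_ne_zero.2 hz)
    rw [Real.rpow_sub_one hz'.ne', absProd, ← Finset.prod_erase_mul _ _ (Finset.mem_univ j),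
      mul_div_assoc]
    gcongr
    exact prod_abs_rpow_le _ γ hγ x (x j) z

omit hγ in
lemma hasDerivAt_absProd_mul_exp {z : ℝ} (hz : ∀ k, z ≠ x k) :
    HasDerivAt (fun z => absProd γ x z * Real.exp (-z ^ 2))
      (absProd γ x z * Real.exp (-z ^ 2) * (∑ k, γ k / (z - x k) - 2 * z)) z := by
  have heq : ∀ y, (∀ k, y ≠ x k) → absProd γ x y * Real.exp (-y ^ 2)
      = Real.exp (∑ k, γ k * Real.log (y - x k) - y ^ 2) := by
    intro y hy
    rw [sub_eq_add_neg, Real.exp_add, Real.exp_sum, absProd]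
    congr 1
    refine Finset.prod_congr rfl fun k _ => ?_
    rw [Real.rpow_def_of_pos (abs_pos.2 (sub_ne_zero.2 (hy k))), Real.log_abs, mul_comm]
  have hev : ∀ᶠ y in nhds z, ∀ k, y ≠ x k :=
    Filter.eventually_all.2 fun k => isOpen_ne.mem_nhds (hz k)
  rw [heq z hz]
  refine HasDerivAt.congr_of_eventuallyEq ?_ (hev.mono heq)
  refine (HasDerivAt.sub (HasDerivAt.fun_sum fun k _ =>
    (((hasDerivAt_id z).sub_const (x k)).log (sub_ne_zero.2 (hz k))).const_mul (γ k))
    (hasDerivAt_pow 2 z)).exp.congr_deriv ?_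
  simp [div_eq_mul_inv]

lemma tendsto_absProd_mul_zero {l : Filter ℝ} (hl : Filter.Tendsto (fun z : ℝ => |z|) l .atTop)
    (q : ℝ[X]) : Filter.Tendsto (fun z => absProd γ x z * (q.eval z * Real.exp (-z ^ 2))) l
      (nhds 0) := by
  obtain ⟨C, B, hC, -, hb⟩ := exists_abs_eval_mul_exp_le q
  set A := ∑ k, γ k * |0 - x k|
  set D := ∑ k, γ k
  have h0 : Filter.Tendsto (fun z : ℝ => C * Real.exp A * Real.exp (-(|z| * (|z| - (D + B))))) l
      (nhds 0) := by
    have := hl.atTop_mul_atTop₀ (Filter.tendsto_atTop_add_const_right l (-(D + B)) hl)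
    simpa [sub_eq_add_neg] using (Real.tendsto_exp_neg_atTop_nhds_zero.comp this).const_mul
      (C * Real.exp A)
  refine squeeze_zero_norm (fun z => ?_) h0
  have h1 : |absProd γ x z| ≤ Real.exp (A + D * |z - 0|) := by
    rw [abs_of_nonneg (absProd_nonneg x z)]
    exact prod_abs_rpow_le _ γ hγ x 0 z
  have h2 := hb z 0 (by simp)
  rw [sub_zero] at h1
  rw [add_zero] at h2
  rw [Real.norm_eq_abs, abs_mul]
  refine (mul_le_mul h1 h2 (abs_nonneg _) (Real.exp_pos _).le).trans_eq ?_
  rw [mul_left_comm, ← Real.exp_add, mul_assoc, ← Real.exp_add]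
  congr 2
  rw [← sq_abs z]
  ring

/-- The functional `q ↦ ∫ q w` attached to the weight with singularities `x`. -/
noncomputable def weightFunctional : ℝ[X] →ₗ[ℝ] ℝ := (gaussAdmissible_absProd hγ x).functional

/-- The functional `q ↦ ∫ q(y) w(y) / (y - x j) dy`. -/
noncomputable def cauchyFunctional (j : Fin N) : ℝ[X] →ₗ[ℝ] ℝ :=
  (gaussAdmissible_absProd_div hγ x j).functional

lemma cauchyFunctional_sub_mul (j : Fin N) (q : ℝ[X]) :
    cauchyFunctional hγ x j ((X - C (x j)) * q) = weightFunctional hγ x q := by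
  refine integral_congr_ae ?_
  filter_upwards [compl_mem_ae_iff.2 (measure_singleton (x j))] with z hz
  have hz' : z - x j ≠ 0 := sub_ne_zero.2 hz
  simp only [eval_mul, eval_sub, eval_X, eval_C]
  field_simp

lemma weightFunctional_integration_by_parts (q : ℝ[X]) :
    weightFunctional hγ x (derivative q - 2 * X * q) + ∑ k, γ k * cauchyFunctional hγ x k q = 0 := by
  set f : ℝ → ℝ := fun z => absProd γ x z * (q.eval z * Real.exp (-z ^ 2)) with hf
  set f' : ℝ → ℝ := fun z =>
    absProd γ x z * ((derivative q - 2 * X * q).eval z * Real.exp (-z ^ 2)) +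
      ∑ k, γ k * (absProd γ x z / (z - x k) * (q.eval z * Real.exp (-z ^ 2))) with hf'
  have hi1 := (gaussAdmissible_absProd hγ x).integrable (derivative q - 2 * X * q)
  have hi2 : ∀ k, Integrable fun z =>
      γ k * (absProd γ x z / (z - x k) * (q.eval z * Real.exp (-z ^ 2))) := fun k =>
    ((gaussAdmissible_absProd_div hγ x k).integrable q).const_mul (γ k)
  have hi : Integrable f' := hi1.add (integrable_finsetSum _ fun k _ => hi2 k)
  have hint : ∫ z, f' z = weightFunctional hγ x (derivative q - 2 * X * q) +
      ∑ k, γ k * cauchyFunctional hγ x k q := by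
    rw [hf', integral_add hi1 (integrable_finsetSum _ fun k _ => hi2 k),
      integral_finsetSum _ fun k _ => hi2 k]
    simp only [integral_const_mul]
    rfl
  rw [← hint]
  have hcont : Continuous f := by
    have := continuous_absProd hγ x
    have := q.continuous
    fun_prop
  have hderiv : ∀ z ∉ Set.range x, HasDerivAt f (f' z) z := by
    intro z hz
    have hz' : ∀ k, z ≠ x k := fun k hk => hz ⟨k, hk.symm⟩
    have := (hasDerivAt_absProd_mul_exp (γ := γ) x hz').mul (q.hasDerivAt z)
    refine (this.congr_of_eventuallyEq (Filter.Eventually.of_forall fun y => ?_)).congr_deriv ?_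
    · simp only [hf, Pi.mul_apply]
      ring
    · have : ∑ k, γ k * (absProd γ x z / (z - x k) * (q.eval z * Real.exp (-z ^ 2)))
          = absProd γ x z * Real.exp (-z ^ 2) * q.eval z * ∑ k, γ k / (z - x k) := by
        rw [Finset.mul_sum]
        exact Finset.sum_congr rfl fun k _ => by ring
      simp only [hf', this]
      simp
      ring
  have hlim := intervalIntegral_tendsto_integral hi Filter.tendsto_neg_atTop_atBot Filter.tendsto_id
  have heq : ∀ b : ℝ, ∫ z in (-b)..(id b), f' z = f b - f (-b) := fun b =>
    integral_eq_of_hasDerivAt_off_countable f f' (Set.countable_range x) hcont.continuousOn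
      (fun z hz => hderiv z hz.2) hi.intervalIntegrable
  simp only [heq] at hlim
  refine tendsto_nhds_unique hlim ?_
  have h1 := tendsto_absProd_mul_zero hγ x Filter.tendsto_abs_atTop_atTop q
  have h2 := (tendsto_absProd_mul_zero hγ x Filter.tendsto_abs_atBot_atTop q).comp
    Filter.tendsto_neg_atTop_atBot
  simpa [hf] using h1.sub h2

lemma hasDerivAt_weightFunctional_shift (q : ℝ[X]) :
    HasDerivAt (fun s => weightFunctional hγ (fun k => x k + s) q)
      (weightFunctional hγ x (derivative q - 2 * X * q)) 0 := by
  have h := (gaussAdmissible_absProd hγ x).hasDerivAt_integral_shift q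
  refine h.congr_of_eventuallyEq (Filter.Eventually.of_forall fun s => ?_)
  simp only [weightFunctional, GaussAdmissible.functional_apply]
  rw [← integral_add_right_eq_self _ s]
  simp only [absProd_add_const]

lemma hasDerivAt_cauchyFunctional_shift (j : Fin N) (q : ℝ[X]) :
    HasDerivAt (fun s => cauchyFunctional hγ (fun k => x k + s) j q)
      (cauchyFunctional hγ x j (derivative q - 2 * X * q)) 0 := by
  have h := (gaussAdmissible_absProd_div hγ x j).hasDerivAt_integral_shift q
  refine h.congr_of_eventuallyEq (Filter.Eventually.of_forall fun s => ?_)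
  simp only [cauchyFunctional, GaussAdmissible.functional_apply]
  rw [← integral_add_right_eq_self _ s]
  simp only [absProd_add_const, add_sub_add_right_eq_sub]

end AbsProd

lemma hasDerivAt_coeff_mul {p q : ℝ → ℝ[X]} {p' q' : ℝ[X]} {s₀ : ℝ}
    (hp : ∀ k, HasDerivAt (fun s => (p s).coeff k) (p'.coeff k) s₀)
    (hq : ∀ k, HasDerivAt (fun s => (q s).coeff k) (q'.coeff k) s₀) (k : ℕ) :
    HasDerivAt (fun s => (p s * q s).coeff k) ((p' * q s₀ + p s₀ * q').coeff k) s₀ := by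
  simp only [coeff_add, coeff_mul, ← Finset.sum_add_distrib]
  exact HasDerivAt.fun_sum fun i _ => (hp i.1).mul (hq i.2)

lemma hasDerivAt_functional_family {Λ : ℝ → ℝ[X] →ₗ[ℝ] ℝ}
    (hΛ : ∀ q, HasDerivAt (fun s => Λ s q) (Λ 0 (derivative q - 2 * X * q)) 0)
    {q : ℝ → ℝ[X]} {q' : ℝ[X]} {d : ℕ} (hd : ∀ᶠ s in nhds 0, (q s).natDegree < d)
    (hd' : q'.natDegree < d)
    (hc : ∀ k, HasDerivAt (fun s => (q s).coeff k) (q'.coeff k) 0) :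
    HasDerivAt (fun s => Λ s (q s)) (Λ 0 (q' + derivative (q 0) - 2 * X * q 0)) 0 := by
  have expand : ∀ (M : ℝ[X] →ₗ[ℝ] ℝ) (p : ℝ[X]), p.natDegree < d →
      M p = ∑ i ∈ Finset.range d, p.coeff i * M (X ^ i) := by
    intro M p hp
    conv_lhs => rw [as_sum_range_C_mul_X_pow' p hp]
    simp [← smul_eq_C_mul]
  have expand' : Λ 0 (q' + derivative (q 0) - 2 * X * q 0) = ∑ i ∈ Finset.range d,
      (q'.coeff i * Λ 0 (X ^ i) + (q 0).coeff i * Λ 0 (derivative (X ^ i) - 2 * X * X ^ i)) := by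
    have := expand ((Λ 0) ∘ₗ (derivative - LinearMap.mulLeft ℝ (2 * X))) (q 0) hd.self_of_nhds
    simp only [LinearMap.comp_apply, LinearMap.sub_apply, LinearMap.mulLeft_apply] at this
    rw [Finset.sum_add_distrib, ← this, ← expand _ _ hd', add_sub_assoc, map_add]
  rw [expand']
  exact (HasDerivAt.fun_sum fun i _ => (hc i).mul (hΛ (X ^ i))).congr_of_eventuallyEq
    (hd.mono fun s hs => expand (Λ s) (q s) hs)

/-- A family of monic polynomials, orthogonal with respect to a positive functional. -/
structure IsMonicOrthogonal (L : ℝ[X] →ₗ[ℝ] ℝ) (P : ℕ → ℝ[X]) : Prop where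
  monic : ∀ n, (P n).Monic
  natDegree_eq : ∀ n, (P n).natDegree = n
  orthogonal : ∀ m n, m ≠ n → L (P m * P n) = 0
  pos : ∀ n, 0 < L (P n * P n)

namespace IsMonicOrthogonal

variable {L : ℝ[X] →ₗ[ℝ] ℝ} {P : ℕ → ℝ[X]} (hP : IsMonicOrthogonal L P)
include hP

lemma coeff_self (n : ℕ) : (P n).coeff n = 1 := by
  have := (hP.monic n).coeff_natDegree
  rwa [hP.natDegree_eq] at this

lemma coeff_eq_zero {n k : ℕ} (h : n < k) : (P n).coeff k = 0 :=
  coeff_eq_zero_of_natDegree_lt (by rwa [hP.natDegree_eq])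

lemma degree_sub_lt {d : ℕ} {q : ℝ[X]} (hq : q.degree < (d + 1 : ℕ)) :
    (q - C (q.coeff d) * P d).degree < d := by
  rw [degree_lt_iff_coeff_zero] at hq ⊢
  intro k hk
  rcases hk.eq_or_lt with rfl | hk
  · simp [hP.coeff_self]
  · simp [hP.coeff_eq_zero hk, hq k hk]

lemma apply_mul_of_degree_lt {n : ℕ} {q : ℝ[X]} (hq : q.degree < n) : L (P n * q) = 0 := by
  suffices ∀ d ≤ n, ∀ q : ℝ[X], q.degree < d → L (P n * q) = 0 from this n le_rfl q hq
  intro d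
  induction d with
  | zero =>
    intro _ q hq
    have : q = 0 := by simpa [Nat.WithBot.lt_zero_iff] using hq
    simp [this]
  | succ d ih =>
    intro hd q hq
    have h1 := ih (by omega) _ (hP.degree_sub_lt hq)
    have h2 := hP.orthogonal n d (by omega)
    rw [mul_sub, map_sub, mul_left_comm, ← smul_eq_C_mul, map_smul, h2] at h1
    simpa using h1

lemma apply_mul_of_degree_lt_succ {n : ℕ} {q : ℝ[X]} (hq : q.degree < (n + 1 : ℕ)) :
    L (P n * q) = q.coeff n * L (P n * P n) := by
  have h1 := hP.apply_mul_of_degree_lt (hP.degree_sub_lt hq)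
  rw [mul_sub, map_sub, mul_left_comm, ← smul_eq_C_mul, map_smul, smul_eq_mul] at h1
  linarith

lemma eq_zero_of_apply_mul {n : ℕ} {q : ℝ[X]} (hq : q.degree < n)
    (h : ∀ m < n, L (P m * q) = 0) : q = 0 := by
  induction n with
  | zero => simpa [Nat.WithBot.lt_zero_iff] using hq
  | succ n ih =>
    have h1 := h n (by omega)
    rw [hP.apply_mul_of_degree_lt_succ hq] at h1
    have h2 : q.coeff n = 0 := (mul_eq_zero.1 h1).resolve_right (hP.pos n).ne'
    refine ih ?_ fun m hm => h m (by omega)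
    have h3 := hP.degree_sub_lt hq
    simpa [h2] using h3

lemma degree_X_mul_lt {m n : ℕ} (h : m + 1 < n) :
    (X * P m).degree < (n : WithBot ℕ) := by
  rw [degree_lt_iff_coeff_zero]
  intro k hk
  obtain ⟨k, rfl⟩ : ∃ i, k = i + 1 := ⟨k - 1, by omega⟩
  rw [coeff_X_mul]
  exact hP.coeff_eq_zero (by omega)

lemma apply_mul_X_mul (m : ℕ) : L (P (m + 1) * (X * P m)) = L (P (m + 1) * P (m + 1)) := by
  rw [hP.apply_mul_of_degree_lt_succ (hP.degree_X_mul_lt (by omega)), coeff_X_mul,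
    hP.coeff_self, one_mul]

lemma degree_divByMonic_lt {n : ℕ} (t : ℝ) :
    (P n /ₘ (X - C t)).degree < n := by
  have : (P n).degree = n := by
    rw [degree_eq_natDegree (hP.monic n).ne_zero, hP.natDegree_eq]
  rw [← this]
  exact Polynomial.degree_divByMonic_lt _ (X - C t) (hP.monic n).ne_zero (by simp)

section Cauchy

variable {G : ℝ[X] →ₗ[ℝ] ℝ} {t : ℝ} (hG : ∀ q, G ((X - C t) * q) = L q)
include hG

omit hP in
lemma cauchy_X_mul (q : ℝ[X]) : G (X * q) = L q + t * G q := by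
  have := hG q
  rw [sub_mul, map_sub, ← smul_eq_C_mul, map_smul, smul_eq_mul] at this
  linarith

omit hP in
lemma cauchy_mul (p q : ℝ[X]) :
    G (p * q) = q.eval t * G p + L (p * (q /ₘ (X - C t))) := by
  have h := modByMonic_add_div q (X - C t)
  rw [modByMonic_X_sub_C_eq_C_eval] at h
  conv_lhs => rw [← h]
  rw [mul_add, map_add, mul_left_comm p (X - C t), hG, mul_comm p (C _), ← smul_eq_C_mul, map_smul,
    smul_eq_mul]

lemma cauchy_determinant (m : ℕ) :
    G (P (m + 1) * P (m + 1)) * G (P m * P m) =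
      G (P (m + 1) * P m) * (G (P (m + 1) * P m) - L (P m * P m)) := by
  have e1 : G (P (m + 1) * P (m + 1)) = (P (m + 1)).eval t * G (P (m + 1)) := by
    rw [cauchy_mul hG, hP.apply_mul_of_degree_lt (hP.degree_divByMonic_lt t), add_zero]
  have e2 : G (P m * P m) = (P m).eval t * G (P m) := by
    rw [cauchy_mul hG, hP.apply_mul_of_degree_lt (hP.degree_divByMonic_lt t), add_zero]
  have e3 : G (P (m + 1) * P m) = (P m).eval t * G (P (m + 1)) := by
    rw [cauchy_mul hG, hP.apply_mul_of_degree_lt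
      ((hP.degree_divByMonic_lt t).trans (by exact_mod_cast m.lt_succ_self)), add_zero]
  have e4 : G (P (m + 1) * P m) = (P (m + 1)).eval t * G (P m) + L (P m * P m) := by
    have hc : (P (m + 1) /ₘ (X - C t)).coeff m = 1 := by
      rw [coeff_divByMonic_X_sub_C, hP.natDegree_eq, Finset.Icc_self, Finset.sum_singleton,
        hP.coeff_self]
      simp
    rw [mul_comm, cauchy_mul hG, hP.apply_mul_of_degree_lt_succ (hP.degree_divByMonic_lt t), hc,
      one_mul]
  rw [e1, e2]
  linear_combination (-G (P (m + 1) * P m)) * e4 + (P (m + 1)).eval t * G (P m) * -e3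

end Cauchy

lemma derivative_degree_lt (n : ℕ) : (derivative (P n)).degree < n := by
  have : (P n).degree = n := by
    rw [degree_eq_natDegree (hP.monic n).ne_zero, hP.natDegree_eq]
  rw [← this]
  exact degree_derivative_lt (hP.monic n).ne_zero

section IntegrationByParts

variable {N : ℕ} {γ : Fin N → ℝ} {G : Fin N → ℝ[X] →ₗ[ℝ] ℝ}
  (hibp : ∀ q, L (derivative q - 2 * X * q) + ∑ k, γ k * G k q = 0)
include hibp

lemma two_mul_apply_X_mul_self (n : ℕ) :
    2 * L (X * P n * P n) = ∑ k, γ k * G k (P n * P n) := by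
  have h := hibp (P n * P n)
  have h0 := hP.apply_mul_of_degree_lt (hP.derivative_degree_lt n)
  have e : derivative (P n * P n) - 2 * X * (P n * P n)
      = (2 : ℝ) • (P n * derivative (P n)) - (2 : ℝ) • (X * P n * P n) := by
    rw [derivative_mul, smul_eq_C_mul, smul_eq_C_mul, map_ofNat]
    ring
  rw [e, map_sub, map_smul, map_smul, h0, smul_eq_mul, smul_eq_mul] at h
  linarith

lemma sum_cauchy_apply_succ (m : ℕ) :
    ∑ k, γ k * G k (P (m + 1) * P m) =
      2 * L (P (m + 1) * P (m + 1)) - (m + 1) * L (P m * P m) := by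
  have h := hibp (P (m + 1) * P m)
  have h0 := hP.apply_mul_of_degree_lt ((hP.derivative_degree_lt m).trans
    (by exact_mod_cast m.lt_succ_self : (m : WithBot ℕ) < (m + 1 : ℕ)))
  have h1 : L (P m * derivative (P (m + 1))) = (m + 1) * L (P m * P m) := by
    rw [hP.apply_mul_of_degree_lt_succ (hP.derivative_degree_lt (m + 1)), coeff_derivative,
      hP.coeff_self]
    ring
  have e : derivative (P (m + 1) * P m) - 2 * X * (P (m + 1) * P m)
      = P m * derivative (P (m + 1)) + P (m + 1) * derivative (P m)
        - (2 : ℝ) • (P (m + 1) * (X * P m)) := by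
    rw [derivative_mul, smul_eq_C_mul, map_ofNat]
    ring
  rw [e, map_sub, map_add, map_smul, h0, h1, hP.apply_mul_X_mul, smul_eq_mul] at h
  linarith

end IntegrationByParts

section Flow

variable {D : ℕ → ℝ[X]} (hD : ∀ n, (D n).degree < n)
  (horth : ∀ m n, m ≠ n → L (D m * P n + P m * D n - 2 * X * (P m * P n)) = 0)
include hD

lemma flow_apply_self (n : ℕ) :
    L (D n * P n + P n * D n - 2 * X * (P n * P n)) = -2 * L (X * P n * P n) := by
  have h0 := hP.apply_mul_of_degree_lt (hD n)
  have e : D n * P n + P n * D n - 2 * X * (P n * P n)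
      = (2 : ℝ) • (P n * D n) - (2 : ℝ) • (X * P n * P n) := by
    rw [smul_eq_C_mul, smul_eq_C_mul, map_ofNat]
    ring
  rw [e, map_sub, map_smul, map_smul, h0, smul_eq_mul, smul_eq_mul]
  ring

include horth

lemma apply_mul_flow {i n : ℕ} (h : i < n) : L (P i * D n) = 2 * L (P n * (X * P i)) := by
  have h1 := horth i n h.ne
  have h2 := hP.apply_mul_of_degree_lt ((hD i).trans (by exact_mod_cast h : (i : WithBot ℕ) < n))
  have e : D i * P n + P i * D n - 2 * X * (P i * P n)
      = P n * D i + P i * D n - (2 : ℝ) • (P n * (X * P i)) := by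
    rw [smul_eq_C_mul, map_ofNat]
    ring
  rw [e, map_sub, map_add, map_smul, h2, smul_eq_mul] at h1
  linarith

lemma flow_succ (m : ℕ) :
    D (m + 1) = C (2 * L (P (m + 1) * P (m + 1)) / L (P m * P m)) * P m := by
  refine sub_eq_zero.1 (hP.eq_zero_of_apply_mul (n := m + 1) ?_ fun i hi => ?_)
  · have hDm := hD (m + 1)
    rw [degree_lt_iff_coeff_zero] at hDm ⊢
    intro k hk
    rw [coeff_sub, coeff_C_mul, hDm k hk, hP.coeff_eq_zero (by omega), mul_zero, sub_zero]
  · rw [mul_sub, map_sub, mul_left_comm, ← smul_eq_C_mul, map_smul,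
      hP.apply_mul_flow hD horth hi, smul_eq_mul]
    rcases eq_or_ne i m with rfl | him
    · rw [hP.apply_mul_X_mul, div_mul_cancel₀ _ (hP.pos i).ne', sub_self]
    · rw [hP.orthogonal i m him, hP.apply_mul_of_degree_lt (hP.degree_X_mul_lt (by omega))]
      simp

lemma flow_eq (m : ℕ) :
    D m = 2 * (X * P m - C (L (X * P m * P m) / L (P m * P m)) * P m - P (m + 1)) := by
  set a := L (X * P m * P m) / L (P m * P m)
  have ha : a * L (P m * P m) = L (X * P m * P m) := div_mul_cancel₀ _ (hP.pos m).ne'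
  have h2 : (2 : ℝ[X]) = C 2 := (map_ofNat C 2).symm
  refine sub_eq_zero.1 (hP.eq_zero_of_apply_mul (n := m + 1) ?_ fun i hi => ?_)
  · have hDm := hD m
    rw [degree_lt_iff_coeff_zero] at hDm ⊢
    intro k hk
    obtain ⟨k, rfl⟩ : ∃ i, k = i + 1 := ⟨k - 1, by omega⟩
    have hk' : m ≤ k := by omega
    rw [h2, coeff_sub, coeff_C_mul, coeff_sub, coeff_sub, coeff_C_mul, coeff_X_mul,
      hDm _ (by omega), hP.coeff_eq_zero (show m < k + 1 by omega)]
    rcases hk'.eq_or_lt with rfl | hk'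
    · simp [hP.coeff_self]
    · simp [hP.coeff_eq_zero hk', hP.coeff_eq_zero (show m + 1 < k + 1 by omega)]
  · have e : P i * (D m - 2 * (X * P m - C a * P m - P (m + 1))) =
        P i * D m - (2 : ℝ) • (P m * (X * P i) - a • (P i * P m) - P i * P (m + 1)) := by
      rw [smul_eq_C_mul, smul_eq_C_mul, h2]
      ring
    rw [e, map_sub, map_smul, map_sub, map_sub, map_smul, smul_eq_mul, smul_eq_mul,
      hP.orthogonal i (m + 1) (by omega)]
    rcases eq_or_ne i m with rfl | him
    · rw [hP.apply_mul_of_degree_lt (hD i), ha, mul_comm (P i) (X * P i)]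
      ring
    · rw [hP.orthogonal i m him, hP.apply_mul_flow hD horth (by omega)]
      ring

variable {G : ℝ[X] →ₗ[ℝ] ℝ}

lemma cauchy_flow_succ (m : ℕ) :
    G (D (m + 1) * P m + P (m + 1) * D m - 2 * X * (P (m + 1) * P m)) =
      2 * (L (P (m + 1) * P (m + 1)) / L (P m * P m)) * G (P m * P m)
        - 2 * (L (X * P m * P m) / L (P m * P m)) * G (P (m + 1) * P m)
        - 2 * G (P (m + 1) * P (m + 1)) := by
  rw [hP.flow_succ hD horth, hP.flow_eq hD horth m]
  set b := 2 * L (P (m + 1) * P (m + 1)) / L (P m * P m) with hb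
  set a := L (X * P m * P m) / L (P m * P m)
  have e : C b * P m * P m + P (m + 1) * (2 * (X * P m - C a * P m - P (m + 1)))
      - 2 * X * (P (m + 1) * P m)
      = b • (P m * P m) - (2 * a) • (P (m + 1) * P m) - (2 : ℝ) • (P (m + 1) * P (m + 1)) := by
    rw [smul_eq_C_mul, smul_eq_C_mul, smul_eq_C_mul, C_mul, map_ofNat]
    ring
  rw [e, map_sub, map_sub, map_smul, map_smul, map_smul, smul_eq_mul, smul_eq_mul, smul_eq_mul, hb]
  ring

variable {t : ℝ} (hG : ∀ q, G ((X - C t) * q) = L q)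
include hG

lemma cauchy_flow_self (m : ℕ) :
    G (D (m + 1) * P (m + 1) + P (m + 1) * D (m + 1) - 2 * X * (P (m + 1) * P (m + 1))) =
      4 * (L (P (m + 1) * P (m + 1)) / L (P m * P m)) * G (P (m + 1) * P m)
        - 2 * L (P (m + 1) * P (m + 1)) - 2 * t * G (P (m + 1) * P (m + 1)) := by
  rw [hP.flow_succ hD horth]
  set b := 2 * L (P (m + 1) * P (m + 1)) / L (P m * P m) with hb
  have e : C b * P m * P (m + 1) + P (m + 1) * (C b * P m) - 2 * X * (P (m + 1) * P (m + 1))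
      = (2 * b) • (P (m + 1) * P m) - (2 : ℝ) • (X * (P (m + 1) * P (m + 1))) := by
    rw [smul_eq_C_mul, smul_eq_C_mul, C_mul, map_ofNat]
    ring
  rw [e, map_sub, map_smul, map_smul, cauchy_X_mul hG, smul_eq_mul, smul_eq_mul, hb]
  ring

end Flow

end IsMonicOrthogonal

section PartialDerivatives

variable {N : ℕ} {f : (Fin N → ℝ) → ℝ} {x : Fin N → ℝ}

lemma pd_eq_fderiv (hf : DifferentiableAt ℝ f x) (k : Fin N) :
    pd k f x = fderiv ℝ f x (Pi.single k 1) := by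
  have h1 := hasDerivAt_update (𝕜 := ℝ) x k (x k)
  have h2 : HasFDerivAt f (fderiv ℝ f x) (Function.update x k (x k)) := by
    rw [Function.update_eq_self]
    exact hf.hasFDerivAt
  exact (h2.comp_hasDerivAt (x k) h1).deriv

lemma hasDerivAt_diagonal (hf : DifferentiableAt ℝ f x) :
    HasDerivAt (fun s : ℝ => f fun k => x k + s) (∑ k, pd k f x) 0 := by
  have h1 : HasDerivAt (fun s : ℝ => fun k => x k + s) (fun _ => (1 : ℝ)) 0 :=
    hasDerivAt_pi.2 fun k => (hasDerivAt_id (0 : ℝ)).const_add (x k)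
  have h2 : HasFDerivAt f (fderiv ℝ f x) (fun k => x k + (0 : ℝ)) := by
    simpa using hf.hasFDerivAt
  refine (h2.comp_hasDerivAt (0 : ℝ) h1).congr_deriv ?_
  have e : (fun _ => (1 : ℝ)) = ∑ k : Fin N, Pi.single k (1 : ℝ) :=
    (Finset.univ_sum_single fun _ : Fin N => (1 : ℝ)).symm
  rw [e, map_sum]
  exact Finset.sum_congr rfl fun k _ => (pd_eq_fderiv hf k).symm

lemma eventually_diagonal_mem {U : Set (Fin N → ℝ)} (hU : IsOpen U) (hx : x ∈ U) :
    ∀ᶠ s : ℝ in nhds 0, (fun k => x k + s) ∈ U := by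
  have hc : Continuous fun s : ℝ => fun k => x k + s := by fun_prop
  exact hc.continuousAt.eventually_mem (hU.mem_nhds (by simpa using hx))

lemma sum_sum_pd_eq_of_hasDerivAt {U : Set (Fin N → ℝ)} (hU : IsOpen U) (hx : x ∈ U)
    (hf : ContDiffOn ℝ 2 f U) {g : (Fin N → ℝ) → ℝ} (hg : ∀ y ∈ U, ∑ l, pd l f y = g y) {v : ℝ}
    (hv : HasDerivAt (fun s : ℝ => g fun k => x k + s) v 0) :
    ∑ k, ∑ l, pd k (pd l f) x = v := by
  have hdiff : ∀ l, DifferentiableAt ℝ (pd l f) x := by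
    intro l
    have h1 : ContDiffOn ℝ 1 (fderiv ℝ f) U := hf.fderiv_of_isOpen hU (by norm_num)
    have h2 : DifferentiableAt ℝ (fun y => fderiv ℝ f y (Pi.single l 1)) x :=
      ((h1.differentiableOn (by norm_num)).differentiableAt (hU.mem_nhds hx)).clm_apply
        (differentiableAt_const _)
    refine h2.congr_of_eventuallyEq ?_
    filter_upwards [hU.mem_nhds hx] with y hy
    exact pd_eq_fderiv ((hf.differentiableOn (by norm_num)).differentiableAt (hU.mem_nhds hy)) l
  have hv' : HasDerivAt (fun s : ℝ => ∑ l, pd l f fun k => x k + s) v 0 :=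
    hv.congr_of_eventuallyEq ((eventually_diagonal_mem hU hx).mono fun s hs => hg _ hs)
  have hv'' := HasDerivAt.fun_sum (u := Finset.univ) fun l _ => hasDerivAt_diagonal (hdiff l)
  rw [Finset.sum_comm]
  exact hv''.unique hv'

end PartialDerivatives

/-- The derivative of a polynomial family along the diagonal, the variable being shifted with the
parameters. -/
noncomputable def diagonalFlow {N : ℕ} (P : ℕ → (Fin N → ℝ) → ℝ[X]) (x : Fin N → ℝ) (n : ℕ) :
    ℝ[X] :=
  (∑ i ∈ Finset.range n, C (∑ k, pd k (fun y => (P n y).coeff i) x) * X ^ i) + derivative (P n x)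

section Flow

variable {N : ℕ} {γ : Fin N → ℝ} (hγ : ∀ k, 0 < γ k) {U : Set (Fin N → ℝ)} (hU : IsOpen U)
  {P : ℕ → (Fin N → ℝ) → ℝ[X]}
  (hP : ∀ x ∈ U, IsMonicOrthogonal (weightFunctional hγ x) fun n => P n x)
  (hPC : ∀ n k, ContDiffOn ℝ 2 (fun x => (P n x).coeff k) U)
  {x : Fin N → ℝ} (hx : x ∈ U)
include hP hx

lemma degree_diagonalFlow_lt (n : ℕ) : (diagonalFlow P x n).degree < n := by
  have h1 := (hP x hx).derivative_degree_lt n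
  rw [degree_lt_iff_coeff_zero] at h1 ⊢
  intro k hk
  rw [diagonalFlow, coeff_add, h1 k hk, finsetSum_coeff, add_zero]
  refine Finset.sum_eq_zero fun i hi => ?_
  rw [coeff_C_mul, coeff_X_pow, if_neg, mul_zero]
  have := Finset.mem_range.1 hi
  omega

include hU hPC

lemma hasDerivAt_functional_diagonal {Λ : (Fin N → ℝ) → ℝ[X] →ₗ[ℝ] ℝ}
    (hΛ : ∀ q, HasDerivAt (fun s : ℝ => Λ (fun k => x k + s) q)
      (Λ x (derivative q - 2 * X * q)) 0) (m n : ℕ) :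
    HasDerivAt (fun s : ℝ => Λ (fun k => x k + s) (P m (fun k => x k + s) * P n fun k => x k + s))
      (Λ x (diagonalFlow P x m * P n x + P m x * diagonalFlow P x n
        - 2 * X * (P m x * P n x))) 0 := by
  have hev := eventually_diagonal_mem hU hx
  have hcoeff : ∀ n k, HasDerivAt (fun s : ℝ => (P n fun k => x k + s).coeff k)
      ((diagonalFlow P x n - derivative (P n x)).coeff k) 0 := by
    intro n k
    rw [diagonalFlow, add_sub_cancel_right, finsetSum_coeff]
    rcases lt_or_ge k n with hk | hk
    · have : ∑ i ∈ Finset.range n,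
          (C (∑ k, pd k (fun y => (P n y).coeff i) x) * X ^ i).coeff k
          = ∑ l, pd l (fun y => (P n y).coeff k) x := by
        simp only [coeff_C_mul, coeff_X_pow]
        simp [hk]
      rw [this]
      exact hasDerivAt_diagonal
        (((hPC n k).differentiableOn (by norm_num)).differentiableAt (hU.mem_nhds hx))
    · have : ∑ i ∈ Finset.range n,
          (C (∑ k, pd k (fun y => (P n y).coeff i) x) * X ^ i).coeff k = 0 := by
        refine Finset.sum_eq_zero fun i hi => ?_
        rw [coeff_C_mul, coeff_X_pow, if_neg, mul_zero]
        have := Finset.mem_range.1 hi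
        omega
      rw [this]
      refine (hasDerivAt_const (0 : ℝ) (if k = n then (1 : ℝ) else 0)).congr_of_eventuallyEq ?_
      filter_upwards [hev] with s hs
      split_ifs with h
      · rw [h]
        exact (hP _ hs).coeff_self n
      · exact (hP _ hs).coeff_eq_zero (lt_of_le_of_ne hk (Ne.symm h))
  have hdeg : ∀ n, (diagonalFlow P x n - derivative (P n x)).natDegree ≤ n := fun n =>
    natDegree_le_of_degree_le ((degree_sub_le _ _).trans
      (max_le (degree_diagonalFlow_lt hγ hP hx n).le ((hP x hx).derivative_degree_lt n).le))
  have hdegP : ∀ n, ∀ y ∈ U, (P n y).natDegree ≤ n := fun n y hy => ((hP y hy).natDegree_eq n).le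
  have e0 : (fun k => x k + (0 : ℝ)) = x := by simp
  have key := hasDerivAt_functional_family (Λ := fun s : ℝ => Λ fun k => x k + s)
    (q := fun s : ℝ => P m (fun k => x k + s) * P n fun k => x k + s) (d := m + n + 1)
    (by simpa only [e0] using hΛ)
    (hev.mono fun s hs => Nat.lt_succ_of_le
      (natDegree_mul_le.trans (add_le_add (hdegP m _ hs) (hdegP n _ hs)))) ?_
    (hasDerivAt_coeff_mul (hcoeff m) (hcoeff n))
  · simp only [e0] at key
    refine key.congr_deriv (congrArg _ ?_)
    rw [derivative_mul]
    ring
  · simp only [e0]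
    exact Nat.lt_succ_of_le ((natDegree_add_le _ _).trans (max_le
      (natDegree_mul_le.trans (add_le_add (hdeg m) (hdegP n _ hx)))
      (natDegree_mul_le.trans (add_le_add (hdegP m _ hx) (hdeg n)))))

lemma weightFunctional_diagonalFlow {m n : ℕ} (hmn : m ≠ n) :
    weightFunctional hγ x (diagonalFlow P x m * P n x + P m x * diagonalFlow P x n
      - 2 * X * (P m x * P n x)) = 0 := by
  have h1 := hasDerivAt_functional_diagonal hγ hU hP hPC hx
    (hasDerivAt_weightFunctional_shift hγ x) m n
  refine h1.unique ((hasDerivAt_const (0 : ℝ) (0 : ℝ)).congr_of_eventuallyEq ?_)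
  filter_upwards [eventually_diagonal_mem hU hx] with s hs
  exact (hP _ hs).orthogonal m n hmn

lemma hasDerivAt_norm_diagonal (n : ℕ) :
    HasDerivAt (fun s : ℝ => weightFunctional hγ (fun k => x k + s)
      (P n (fun k => x k + s) * P n fun k => x k + s))
      (-2 * weightFunctional hγ x (X * P n x * P n x)) 0 :=
  (hasDerivAt_functional_diagonal hγ hU hP hPC hx
    (hasDerivAt_weightFunctional_shift hγ x) n n).congr_deriv
    ((hP x hx).flow_apply_self (degree_diagonalFlow_lt hγ hP hx) n)

lemma hasDerivAt_cauchy_self_diagonal (m : ℕ) (j : Fin N) :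
    HasDerivAt (fun s : ℝ => cauchyFunctional hγ (fun k => x k + s) j
      (P (m + 1) (fun k => x k + s) * P (m + 1) fun k => x k + s))
      (4 * (weightFunctional hγ x (P (m + 1) x * P (m + 1) x)
          / weightFunctional hγ x (P m x * P m x))
            * cauchyFunctional hγ x j (P (m + 1) x * P m x)
        - 2 * weightFunctional hγ x (P (m + 1) x * P (m + 1) x)
        - 2 * x j * cauchyFunctional hγ x j (P (m + 1) x * P (m + 1) x)) 0 :=
  (hasDerivAt_functional_diagonal hγ hU hP hPC hx (Λ := fun y => cauchyFunctional hγ y j)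
    (hasDerivAt_cauchyFunctional_shift hγ x j) (m + 1) (m + 1)).congr_deriv
    ((hP x hx).cauchy_flow_self (degree_diagonalFlow_lt hγ hP hx)
      (fun _ _ => weightFunctional_diagonalFlow hγ hU hP hPC hx)
      (cauchyFunctional_sub_mul hγ x j) m)

lemma hasDerivAt_cauchy_succ_diagonal (m : ℕ) (j : Fin N) :
    HasDerivAt (fun s : ℝ => cauchyFunctional hγ (fun k => x k + s) j
      (P (m + 1) (fun k => x k + s) * P m fun k => x k + s))
      (2 * (weightFunctional hγ x (P (m + 1) x * P (m + 1) x)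
          / weightFunctional hγ x (P m x * P m x))
            * cauchyFunctional hγ x j (P m x * P m x)
        - 2 * (weightFunctional hγ x (X * P m x * P m x) / weightFunctional hγ x (P m x * P m x))
          * cauchyFunctional hγ x j (P (m + 1) x * P m x)
        - 2 * cauchyFunctional hγ x j (P (m + 1) x * P (m + 1) x)) 0 :=
  (hasDerivAt_functional_diagonal hγ hU hP hPC hx (Λ := fun y => cauchyFunctional hγ y j)
    (hasDerivAt_cauchyFunctional_shift hγ x j) (m + 1) m).congr_deriv
    ((hP x hx).cauchy_flow_succ (degree_diagonalFlow_lt hγ hP hx)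
      (fun _ _ => weightFunctional_diagonalFlow hγ hU hP hPC hx) m)

end Flow

theorem generalized_painleve_IV
    (N : ℕ) (hN : 1 ≤ N) (γ : Fin N → ℝ) (hγ : ∀ j, 0 < γ j)
    (U : Set (Fin N → ℝ)) (hU : IsOpen U) (hUinj : ∀ x ∈ U, Function.Injective x)
    (w : (Fin N → ℝ) → ℝ → ℝ)
    (hw : ∀ x ∈ U, ∀ y : ℝ, w x y = Real.exp (-y ^ 2) * ∏ j, |y - x j| ^ γ j)
    (P : ℕ → (Fin N → ℝ) → Polynomial ℝ)
    (hPmonic : ∀ n, ∀ x ∈ U, (P n x).Monic) (hPdeg : ∀ n, ∀ x ∈ U, (P n x).natDegree = n)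
    (horth : ∀ m n, m ≠ n → ∀ x ∈ U, ∫ y : ℝ, (P m x).eval y * (P n x).eval y * w x y = 0)
    (h : ℕ → (Fin N → ℝ) → ℝ)
    (hh : ∀ n, ∀ x ∈ U, h n x = ∫ y : ℝ, ((P n x).eval y) ^ 2 * w x y)
    (hhpos : ∀ n, ∀ x ∈ U, 0 < h n x)
    (β : ℕ → (Fin N → ℝ) → ℝ) (hβ0 : ∀ x ∈ U, β 0 x = 0)
    (hβ : ∀ n, ∀ x ∈ U, β (n + 1) x = h (n + 1) x / h n x)
    (α : ℕ → (Fin N → ℝ) → ℝ)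
    (hα : ∀ n, ∀ x ∈ U, α n x = (∫ y : ℝ, y * ((P n x).eval y) ^ 2 * w x y) / h n x)
    (p : ℕ → (Fin N → ℝ) → ℝ) (hp0 : ∀ x ∈ U, p 0 x = 0)
    (hp : ∀ n, ∀ x ∈ U, p (n + 1) x = (P (n + 1) x).coeff n)
    (R : ℕ → Fin N → (Fin N → ℝ) → ℝ)
    (hR : ∀ n j, ∀ x ∈ U, R n j x = γ j / h n x * ∫ y : ℝ, ((P n x).eval y) ^ 2 * w x y / (y - x j))
    (r : ℕ → Fin N → (Fin N → ℝ) → ℝ) (hr0 : ∀ j, ∀ x ∈ U, r 0 j x = 0)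
    (hr : ∀ n j, ∀ x ∈ U, r (n + 1) j x = γ j / h n x * ∫ y : ℝ, (P (n + 1) x).eval y * (P n x).eval y * w x y / (y - x j))
    (hPC2 : ∀ m k, ContDiffOn ℝ 2 (fun x => (P m x).coeff k) U)
    (hhC2 : ∀ m, ContDiffOn ℝ 2 (h m) U)
    (hαC2 : ∀ m, ContDiffOn ℝ 2 (α m) U)
    (hβC2 : ∀ m, ContDiffOn ℝ 2 (β m) U)
    (hpC2 : ∀ m, ContDiffOn ℝ 2 (p m) U)
    (hRC2 : ∀ m j, ContDiffOn ℝ 2 (R m j) U)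
    (hrC2 : ∀ m j, ContDiffOn ℝ 2 (r m j) U)
    (n : ℕ) (hn : 1 ≤ n) (j : Fin N) (x : Fin N → ℝ) (hx : x ∈ U) (hRne : R n j x ≠ 0) :
    (1 / 2) * (∑ k, ∑ l, pd k (pd l (R n j)) x) =
        (∑ k, pd k (R n j) x) ^ 2 / (4 * R n j x)
        - (∑ k, ((x k - (1 / 2) * ∑ l, R n l x) * R n k x + γ k)) * R n j x
        + (x j - (1 / 2) * ∑ k, R n k x) ^ 2 * R n j x
        - (2 * (n : ℝ) + 1) * R n j x - γ j ^ 2 / R n j x := by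
  obtain ⟨m, rfl⟩ : ∃ m, n = m + 1 := ⟨n - 1, by omega⟩
  have hL : ∀ x ∈ U, ∀ q : ℝ[X], ∫ y, q.eval y * w x y = weightFunctional hγ x q := by
    intro x hx q
    refine integral_congr_ae (Filter.Eventually.of_forall fun y => ?_)
    simp only [hw x hx, absProd]
    ring
  have hG : ∀ x ∈ U, ∀ j, ∀ q : ℝ[X],
      ∫ y, q.eval y * w x y / (y - x j) = cauchyFunctional hγ x j q := by
    intro x hx j q
    refine integral_congr_ae (Filter.Eventually.of_forall fun y => ?_)
    simp only [hw x hx, absProd]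
    ring
  have hh' : ∀ n, ∀ x ∈ U, h n x = weightFunctional hγ x (P n x * P n x) := by
    intro n x hx
    simp only [hh n x hx, ← hL x hx, eval_mul, sq]
  have hPo : ∀ x ∈ U, IsMonicOrthogonal (weightFunctional hγ x) fun n => P n x := fun x hx =>
    { monic := fun n => hPmonic n x hx
      natDegree_eq := fun n => hPdeg n x hx
      orthogonal := fun m n hmn => by simpa only [← hL x hx, eval_mul] using horth m n hmn x hx
      pos := fun n => (hh' n x hx) ▸ hhpos n x hx }
  have hR' : ∀ n j, ∀ x ∈ U,
      R n j x = γ j / h n x * cauchyFunctional hγ x j (P n x * P n x) := by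
    intro n j x hx
    simp only [hR n j x hx, ← hG x hx, eval_mul, sq]
  have hr' : ∀ n j, ∀ x ∈ U,
      r (n + 1) j x = γ j / h n x * cauchyFunctional hγ x j (P (n + 1) x * P n x) := by
    intro n j x hx
    simp only [hr n j x hx, ← hG x hx, eval_mul]
  have hne : ∀ n, ∀ x ∈ U, h n x ≠ 0 := fun n x hx => (hhpos n x hx).ne'
  have e0 : ∀ x : Fin N → ℝ, (fun k => x k + (0 : ℝ)) = x := fun x => by simp
  have halpha : ∀ n, ∀ x ∈ U, weightFunctional hγ x (X * P n x * P n x)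
      = h n x * ((1 / 2) * ∑ k, R n k x) := by
    intro n x hx
    have h1 := (hPo x hx).two_mul_apply_X_mul_self
      (weightFunctional_integration_by_parts hγ x) n
    have h2 : h n x * ∑ k, R n k x = ∑ k, γ k * cauchyFunctional hγ x k (P n x * P n x) := by
      rw [Finset.mul_sum]
      refine Finset.sum_congr rfl fun k _ => ?_
      rw [hR' n k x hx]
      field_simp [hne n x hx]
    linarith
  have hdh : ∀ n, ∀ x ∈ U, HasDerivAt (fun s : ℝ => h n fun k => x k + s)
      (-(h n x * ∑ k, R n k x)) 0 := by
    intro n x hx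
    refine ((hasDerivAt_norm_diagonal hγ hU hPo hPC2 hx n).congr_of_eventuallyEq
      ((eventually_diagonal_mem hU hx).mono fun s hs => hh' n _ hs)).congr_deriv ?_
    rw [halpha n x hx]
    ring
  have hdR : ∀ j, ∀ x ∈ U, HasDerivAt (fun s : ℝ => R (m + 1) j fun k => x k + s)
      ((∑ k, R (m + 1) k x - 2 * x j) * R (m + 1) j x + 4 * r (m + 1) j x - 2 * γ j) 0 := by
    intro j x hx
    have h1 := ((hasDerivAt_const (0 : ℝ) (γ j)).div (hdh (m + 1) x hx)
      (by simpa only [e0] using hne _ x hx)).mul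
      (hasDerivAt_cauchy_self_diagonal hγ hU hPo hPC2 hx m j)
    refine (h1.congr_of_eventuallyEq
      ((eventually_diagonal_mem hU hx).mono fun s hs => hR' (m + 1) j _ hs)).congr_deriv ?_
    simp only [Pi.div_apply, e0]
    rw [← hh' _ x hx, ← hh' _ x hx, hr' m j x hx, hR' (m + 1) j x hx]
    have := hne (m + 1) x hx
    have := hne m x hx
    field_simp
    ring
  have hdr : ∀ j, ∀ x ∈ U, HasDerivAt (fun s : ℝ => r (m + 1) j fun k => x k + s)
      (2 * (h (m + 1) x / h m x) * (R m j x - R (m + 1) j x)) 0 := by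
    intro j x hx
    have h1 := ((hasDerivAt_const (0 : ℝ) (γ j)).div (hdh m x hx)
      (by simpa only [e0] using hne _ x hx)).mul
      (hasDerivAt_cauchy_succ_diagonal hγ hU hPo hPC2 hx m j)
    refine (h1.congr_of_eventuallyEq
      ((eventually_diagonal_mem hU hx).mono fun s hs => hr' m j _ hs)).congr_deriv ?_
    simp only [Pi.div_apply, e0]
    rw [halpha m x hx, ← hh' _ x hx, ← hh' _ x hx, hR' m j x hx, hR' (m + 1) j x hx]
    have := hne (m + 1) x hx
    have := hne m x hx
    field_simp
    ring
  have hdet : ∀ x ∈ U, h (m + 1) x / h m x * R (m + 1) j x * R m j x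
      = r (m + 1) j x * (r (m + 1) j x - γ j) := by
    intro x hx
    have h1 := (hPo x hx).cauchy_determinant (cauchyFunctional_sub_mul hγ x j) m
    rw [← hh' m x hx] at h1
    rw [hR' _ _ x hx, hR' _ _ x hx, hr' _ _ x hx]
    have := hne (m + 1) x hx
    have := hne m x hx
    field_simp
    linear_combination γ j ^ 2 * h1
  have hsum : ∑ k, r (m + 1) k x = 2 * (h (m + 1) x / h m x) - (m + 1) := by
    have h1 := (hPo x hx).sum_cauchy_apply_succ (weightFunctional_integration_by_parts hγ x) m
    have h2 : h m x * ∑ k, r (m + 1) k x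
        = ∑ k, γ k * cauchyFunctional hγ x k (P (m + 1) x * P m x) := by
      rw [Finset.mul_sum]
      refine Finset.sum_congr rfl fun k _ => ?_
      rw [hr' m k x hx]
      field_simp [hne m x hx]
    rw [h1, ← hh' _ x hx, ← hh' _ x hx] at h2
    have := hne m x hx
    field_simp
    linarith
  have hRd : ∀ k, ∀ y ∈ U, DifferentiableAt ℝ (R (m + 1) k) y := fun k y hy =>
    ((hRC2 (m + 1) k).differentiableOn (by norm_num)).differentiableAt (hU.mem_nhds hy)
  have hfirst : ∀ y ∈ U, ∑ k, pd k (R (m + 1) j) y = (∑ k, R (m + 1) k y - 2 * y j)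
      * R (m + 1) j y + 4 * r (m + 1) j y - 2 * γ j := fun y hy =>
    (hasDerivAt_diagonal (hRd j y hy)).unique (hdR j y hy)
  have hsecond := sum_sum_pd_eq_of_hasDerivAt hU hx (hRC2 (m + 1) j) hfirst
    (((((HasDerivAt.fun_sum (u := Finset.univ) fun k _ => hdR k x hx).sub
      (((hasDerivAt_id (0 : ℝ)).const_add (x j)).const_mul 2)).mul (hdR j x hx)).add
      ((hdr j x hx).const_mul 4)).sub_const (2 * γ j))
  have hexpand : ∑ k, ((∑ l, R (m + 1) l x - 2 * x k) * R (m + 1) k x + 4 * r (m + 1) k x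
      - 2 * γ k) = -2 * ∑ k, ((x k - (1 / 2) * ∑ l, R (m + 1) l x) * R (m + 1) k x + γ k)
        + 4 * ∑ k, r (m + 1) k x := by
    generalize ∑ l, R (m + 1) l x = A
    rw [Finset.mul_sum, Finset.mul_sum, ← Finset.sum_add_distrib]
    exact Finset.sum_congr rfl fun k _ => by ring
  simp only [e0, id, Pi.sub_apply] at hsecond
  rw [hexpand, hsum] at hsecond
  rw [hsecond, hfirst x hx]
  have hd := hdet x hx
  set S := ∑ k, ((x k - (1 / 2) * ∑ l, R (m + 1) l x) * R (m + 1) k x + γ k)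
  set A := ∑ k, R (m + 1) k x
  set b := h (m + 1) x / h m x
  push_cast
  field_simp
  linear_combination 64 * hd
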